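/- Let U be a unital of order n ≥ 2 with incidence graph G_U. If m(U) ≥ ⌊c(n)⌋, then i(G_U) = 2(n³ + 1 − ⌊c(n)⌋) / (n²(n² + 1)). -/

import Mathlib

open Finset

/-- A 2-(v,k,λ) design with `b` blocks and `r` blocks through each point:
points form a finset `points` of size `v`, blocks a finset `blocks` of
`k`-element subsets of `points`, every pair of distinct points lying in
exactly `lam` blocks, where `v > k > lam ≥ 1`. -/
structure TwoDesign (α : Type*) [DecidableEq α] where
  v : ℕ
  b : ℕ
  r : ℕ
  k : ℕ
  lam : ℕ
  points : Finset α
  blocks : Finset (Finset α)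
  lam_pos : 0 < lam
  lam_lt_k : lam < k
  k_lt_v : k < v
  card_points : points.card = v
  card_blocks : blocks.card = b
  block_subset : ∀ B ∈ blocks, B ⊆ points
  card_block : ∀ B ∈ blocks, B.card = k
  pair_count : ∀ p ∈ points, ∀ q ∈ points, p ≠ q →
    (blocks.filter fun B => p ∈ B ∧ q ∈ B).card = lam
  point_count : ∀ p ∈ points, (blocks.filter fun B => p ∈ B).card = r

variable {α : Type*} [DecidableEq α]

/-- In the incidence graph, the neighbourhood of a set `X` of points:
the blocks containing at least one point of `X`. -/
def TwoDesign.blockNbhd (D : TwoDesign α) (X : Finset α) : Finset (Finset α) :=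
  D.blocks.filter fun B => ∃ p ∈ X, p ∈ B

/-- In the incidence graph, the neighbourhood of a set `Y` of blocks:
the points lying on at least one block of `Y`. -/
def TwoDesign.pointNbhd (D : TwoDesign α) (Y : Finset (Finset α)) : Finset α :=
  D.points.filter fun p => ∃ B ∈ Y, p ∈ B

/-- A unital of order `n`: a 2-(n³+1, n+1, 1) design; it has
`n⁴ - n³ + n²` blocks and `n²` blocks through each point. -/
def TwoDesign.IsUnital (D : TwoDesign α) (n : ℕ) : Prop :=
  D.v = n ^ 3 + 1 ∧ D.b = n ^ 4 - n ^ 3 + n ^ 2 ∧ D.r = n ^ 2 ∧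
    D.k = n + 1 ∧ D.lam = 1

/-- `c(n) = n² - (√(8n²+9) - 3)/2`. -/
noncomputable def cFun (n : ℕ) : ℝ :=
  (n : ℝ) ^ 2 - (Real.sqrt (8 * (n : ℝ) ^ 2 + 9) - 3) / 2

/-- The vertex-isoperimetric number of the incidence graph of `D`:
a subset `S` of the vertex set `P ∪ 𝓑` is encoded as the pair
`(X, Y) = (S ∩ P, S ∩ 𝓑)`; then `|S| = |X| + |Y|` and
`|N(S)| = |N(Y) \ X| + |N(X) \ Y|`. -/
noncomputable def isoInc (D : TwoDesign α) : ℝ :=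
  sInf { t : ℝ | ∃ X ⊆ D.points, ∃ Y ⊆ D.blocks,
    0 < X.card + Y.card ∧ 2 * (X.card + Y.card) ≤ D.v + D.b ∧
    t = (((D.pointNbhd Y \ X).card + (D.blockNbhd X \ Y).card : ℕ) : ℝ) /
        ((X.card + Y.card : ℕ) : ℝ) }

/-- In the non-incidence graph, the neighbourhood of a set `X` of points:
the blocks missing at least one point of `X`. -/
def TwoDesign.blockNbhdC (D : TwoDesign α) (X : Finset α) : Finset (Finset α) :=
  D.blocks.filter fun B => ∃ p ∈ X, p ∉ B

/-- In the non-incidence graph, the neighbourhood of a set `Y` of blocks: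
the points missed by at least one block of `Y`. -/
def TwoDesign.pointNbhdC (D : TwoDesign α) (Y : Finset (Finset α)) : Finset α :=
  D.points.filter fun p => ∃ B ∈ Y, p ∉ B

/-- The vertex-isoperimetric number of the non-incidence graph of `D`. -/
noncomputable def isoNonInc (D : TwoDesign α) : ℝ :=
  sInf { t : ℝ | ∃ X ⊆ D.points, ∃ Y ⊆ D.blocks,
    0 < X.card + Y.card ∧ 2 * (X.card + Y.card) ≤ D.v + D.b ∧
    t = (((D.pointNbhdC Y \ X).card + (D.blockNbhdC X \ Y).card : ℕ) : ℝ) /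
        ((X.card + Y.card : ℕ) : ℝ) }

/-- An arc of a design: a set of at least 3 points, no three collinear. -/
def TwoDesign.IsArc (D : TwoDesign α) (X : Finset α) : Prop :=
  X ⊆ D.points ∧ 3 ≤ X.card ∧ ∀ B ∈ D.blocks, (B ∩ X).card ≤ 2

/-- `m(U)`: the maximum size of an arc in the design. -/
noncomputable def maxArc (D : TwoDesign α) : ℕ :=
  sSup { k : ℕ | ∃ X : Finset α, D.IsArc X ∧ X.card = k }

namespace TwoDesign

lemma sum_card_inter_mul_card_inter (D : TwoDesign α) (X Z : Finset α) :
    ∑ B ∈ D.blocks, (B ∩ X).card * (B ∩ Z).card =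
      ∑ p ∈ X, ∑ q ∈ Z, (D.blocks.filter fun B => p ∈ B ∧ q ∈ B).card := by
  have h (B : Finset α) : (B ∩ X).card * (B ∩ Z).card =
      ∑ p ∈ X, ∑ q ∈ Z, if p ∈ B ∧ q ∈ B then 1 else 0 := by
    rw [inter_comm B X, inter_comm B Z, ← filter_mem_eq_inter, ← filter_mem_eq_inter,
      card_filter, card_filter, sum_mul_sum]
    refine sum_congr rfl fun p _ => sum_congr rfl fun q _ => ?_
    by_cases hp : p ∈ B <;> by_cases hq : q ∈ B <;> simp [hp, hq]
  simp_rw [h, card_filter]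
  rw [sum_comm]
  exact sum_congr rfl fun p _ => sum_comm

lemma sum_card_inter (D : TwoDesign α) {X : Finset α} (hX : X ⊆ D.points) :
    ∑ B ∈ D.blocks, (B ∩ X).card = X.card * D.r := by
  have h (B : Finset α) : (B ∩ X).card = ∑ p ∈ X, if p ∈ B then 1 else 0 := by
    rw [inter_comm B X, ← filter_mem_eq_inter, card_filter]
  simp_rw [h]
  rw [sum_comm, ← smul_eq_mul, ← sum_const]
  refine sum_congr rfl fun p hp => ?_
  rw [← card_filter, D.point_count p (hX hp)]

lemma sum_card_inter_mul_of_disjoint (D : TwoDesign α) {X Z : Finset α} (hX : X ⊆ D.points)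
    (hZ : Z ⊆ D.points) (hXZ : Disjoint X Z) :
    ∑ B ∈ D.blocks, (B ∩ X).card * (B ∩ Z).card = X.card * (Z.card * D.lam) := by
  rw [sum_card_inter_mul_card_inter, ← smul_eq_mul, ← smul_eq_mul, ← sum_const, ← sum_const]
  refine sum_congr rfl fun p hp => sum_congr rfl fun q hq => ?_
  exact D.pair_count p (hX hp) q (hZ hq) fun h => disjoint_left.1 hXZ hp (h ▸ hq)

lemma sum_card_inter_sq (D : TwoDesign α) {X : Finset α} (hX : X ⊆ D.points) :
    ∑ B ∈ D.blocks, ((B ∩ X).card : ℤ) ^ 2 =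
      X.card * (D.r + (X.card - 1) * D.lam) := by
  have h := D.sum_card_inter_mul_card_inter X X
  have h2 : ∀ p ∈ X, ∑ q ∈ X, (D.blocks.filter fun B => p ∈ B ∧ q ∈ B).card =
      D.r + (X.card - 1) * D.lam := by
    intro p hp
    rw [← add_sum_erase X _ hp]
    congr 1
    · simpa using D.point_count p (hX hp)
    · rw [← card_erase_of_mem hp, ← smul_eq_mul, ← sum_const]
      refine sum_congr rfl fun q hq => ?_
      rw [mem_erase] at hq
      exact D.pair_count p (hX hp) q (hX hq.2) hq.1.symm
  rw [sum_congr rfl h2, sum_const, smul_eq_mul] at h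
  rcases X.eq_empty_or_nonempty with rfl | hne
  · simp
  have h1 : 1 ≤ X.card := hne.card_pos
  zify [h1] at h
  simpa only [pow_two] using h

lemma card_inter_eq_zero_of_notMem_blockNbhd (D : TwoDesign α) {X B : Finset α}
    (hB : B ∈ D.blocks) (h : B ∉ D.blockNbhd X) : (B ∩ X).card = 0 := by
  rw [card_eq_zero, eq_empty_iff_forall_notMem]
  intro p hp
  rw [mem_inter] at hp
  exact h (mem_filter.2 ⟨hB, p, hp.2, hp.1⟩)

lemma one_le_card_inter_of_mem_blockNbhd (D : TwoDesign α) {X B : Finset α}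
    (h : B ∈ D.blockNbhd X) : 1 ≤ (B ∩ X).card := by
  obtain ⟨-, p, hp, hpB⟩ := mem_filter.1 h
  exact card_pos.2 ⟨p, mem_inter.2 ⟨hpB, hp⟩⟩

lemma blockNbhd_subset (D : TwoDesign α) (X : Finset α) : D.blockNbhd X ⊆ D.blocks :=
  filter_subset _ _

lemma blockNbhd_mono (D : TwoDesign α) {X Z : Finset α} (h : X ⊆ Z) :
    D.blockNbhd X ⊆ D.blockNbhd Z := by
  intro B hB
  obtain ⟨hB, p, hp, hpB⟩ := mem_filter.1 hB
  exact mem_filter.2 ⟨hB, p, h hp, hpB⟩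

lemma sum_blockNbhd (D : TwoDesign α) (X : Finset α) (f : ℤ → ℤ) (hf : f 0 = 0) :
    ∑ B ∈ D.blockNbhd X, f (B ∩ X).card = ∑ B ∈ D.blocks, f (B ∩ X).card := by
  refine sum_subset (D.blockNbhd_subset X) fun B hB h => ?_
  rw [D.card_inter_eq_zero_of_notMem_blockNbhd hB h, Nat.cast_zero, hf]

lemma sum_blocks_bonferroni (D : TwoDesign α) {X : Finset α} (hX : X ⊆ D.points) :
    ∑ B ∈ D.blocks, (3 * ((B ∩ X).card : ℤ) - ((B ∩ X).card : ℤ) ^ 2) =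
      2 * (X.card : ℤ) * D.r - X.card * (X.card - 1) * D.lam := by
  rw [sum_sub_distrib, ← mul_sum, sum_card_inter_sq D hX]
  have := D.sum_card_inter hX
  zify at this
  rw [this]
  ring

lemma two_mul_card_blockNbhd_ge (D : TwoDesign α) {X : Finset α} (hX : X ⊆ D.points) :
    2 * (X.card : ℤ) * D.r - X.card * (X.card - 1) * D.lam ≤ 2 * (D.blockNbhd X).card := by
  rw [← D.sum_blocks_bonferroni hX, ← D.sum_blockNbhd X (fun a => 3 * a - a ^ 2) (by simp),
    mul_comm, ← nsmul_eq_mul]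
  refine sum_le_card_nsmul _ _ _ fun B hB => ?_
  have h := D.one_le_card_inter_of_mem_blockNbhd hB
  rcases h.eq_or_lt with h | h
  · simp [← h]
  · have : (2 : ℤ) ≤ (B ∩ X).card := by exact_mod_cast h
    nlinarith

lemma two_mul_card_blockNbhd_of_card_inter_le_two (D : TwoDesign α) {X : Finset α}
    (hX : X ⊆ D.points) (h2 : ∀ B ∈ D.blocks, (B ∩ X).card ≤ 2) :
    2 * ((D.blockNbhd X).card : ℤ) = 2 * X.card * D.r - X.card * (X.card - 1) * D.lam := by
  rw [← D.sum_blocks_bonferroni hX, ← D.sum_blockNbhd X (fun a => 3 * a - a ^ 2) (by simp),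
    mul_comm, ← nsmul_eq_mul]
  symm
  refine sum_eq_card_nsmul fun B hB => ?_
  have h := D.one_le_card_inter_of_mem_blockNbhd hB
  have h' := h2 B (D.blockNbhd_subset X hB)
  generalize (B ∩ X).card = a at *
  interval_cases a <;> norm_num

lemma sq_card_mul_le (D : TwoDesign α) {X : Finset α} (hX : X ⊆ D.points) :
    ((X.card : ℤ) * D.r) ^ 2 ≤
      (D.blockNbhd X).card * (X.card * (D.r + (X.card - 1) * D.lam)) := by
  have h := D.sum_card_inter hX
  zify at h
  rw [← D.sum_card_inter_sq hX, ← h, ← D.sum_blockNbhd X (fun a => a) rfl,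
    ← D.sum_blockNbhd X (fun a => a ^ 2) (by simp)]
  exact sq_sum_le_card_mul_sum_sq

lemma card_mul_card_le (D : TwoDesign α) {X Z : Finset α} (hX : X ⊆ D.points)
    (hZ : Z ⊆ D.points) (hXZ : Disjoint X Z) :
    X.card * (Z.card * D.lam) ≤ (D.blockNbhd X ∩ D.blockNbhd Z).card * (D.k ^ 2 / 4) := by
  rw [← D.sum_card_inter_mul_of_disjoint hX hZ hXZ,
    ← sum_subset (inter_subset_left.trans (D.blockNbhd_subset X) :
      D.blockNbhd X ∩ D.blockNbhd Z ⊆ D.blocks), ← smul_eq_mul]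
  · refine sum_le_card_nsmul _ _ _ fun B hB => ?_
    have hB := D.blockNbhd_subset X (mem_inter.1 hB).1
    have hd : Disjoint (B ∩ X) (B ∩ Z) := hXZ.mono inter_subset_right inter_subset_right
    have hc : (B ∩ X).card + (B ∩ Z).card ≤ D.k := by
      rw [← card_union_of_disjoint hd, ← D.card_block B hB]
      exact card_le_card (union_subset inter_subset_left inter_subset_left)
    rw [Nat.le_div_iff_mul_le (by norm_num)]
    nlinarith [four_mul_le_sq_add (B ∩ X).card (B ∩ Z).card, Nat.pow_le_pow_left hc 2]
  · intro B hB h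
    rw [mem_inter, not_and_or] at h
    rcases h with h | h <;> simp [D.card_inter_eq_zero_of_notMem_blockNbhd hB h]

end TwoDesign

/-- The integer `K` is the floor of the smaller root of `t² - (2n² + 3) t + n² (n² + 1)`. -/
structure IsArcThreshold (n K : ℤ) : Prop where
  eval_nonneg : (2 * n ^ 2 + 3) * K - K ^ 2 ≤ n ^ 2 * (n ^ 2 + 1)
  eval_succ_neg : n ^ 2 * (n ^ 2 + 1) < (2 * n ^ 2 + 3) * (K + 1) - (K + 1) ^ 2
  lower : n ^ 2 - 2 * n ≤ K
  upper : K < n ^ 2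

lemma isArcThreshold_floor_cFun {n : ℕ} (hn : 2 ≤ n) : IsArcThreshold n ⌊cFun n⌋ := by
  have hn' : (2 : ℝ) ≤ n := by exact_mod_cast hn
  have h1 := Int.floor_le (cFun n)
  have h2 := Int.lt_floor_add_one (cFun n)
  have hlow : (n : ℤ) ^ 2 - 2 * n ≤ ⌊cFun n⌋ := by
    rw [Int.le_floor]
    have : Real.sqrt (8 * (n : ℝ) ^ 2 + 9) ≤ 4 * n + 3 := by
      rw [Real.sqrt_le_left (by positivity)]
      nlinarith
    push_cast
    unfold cFun
    linarith
  generalize ⌊cFun n⌋ = K at *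
  unfold cFun at h1 h2
  have hs := Real.sq_sqrt (show (0 : ℝ) ≤ 8 * (n : ℝ) ^ 2 + 9 by positivity)
  have hs3 : 3 < Real.sqrt (8 * (n : ℝ) ^ 2 + 9) := by
    rw [Real.lt_sqrt (by norm_num)]
    nlinarith
  generalize Real.sqrt (8 * (n : ℝ) ^ 2 + 9) = s at *
  refine ⟨?_, ?_, hlow, ?_⟩ <;> rify
  · nlinarith [mul_nonneg (sub_nonneg.2 h1)
      (show (0 : ℝ) ≤ (n : ℝ) ^ 2 + (s + 3) / 2 - K by linarith)]
  · nlinarith [mul_pos (sub_pos.2 h2)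
      (show (0 : ℝ) < (n : ℝ) ^ 2 + (s + 3) / 2 - (K + 1) by linarith)]
  · linarith

namespace IsArcThreshold

variable {n K : ℤ}

lemma eq_two (h : IsArcThreshold 2 K) : K = 2 := by
  obtain ⟨h1, h2, h3, h4⟩ := h
  norm_num at h3 h4
  interval_cases K <;> omega

lemma eq_six (h : IsArcThreshold 3 K) : K = 6 := by
  obtain ⟨h1, h2, h3, h4⟩ := h
  norm_num at h3 h4
  interval_cases K <;> omega

lemma two_mul_le (h : IsArcThreshold n K) (hn : 4 ≤ n) {w : ℤ} (hw : 4 * w ≤ (n + 1) ^ 2) :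
    2 * w ≤ K + 1 := by
  obtain ⟨h1, h2, h3, h4⟩ := h
  rcases le_or_gt 6 n with h6 | h6
  · nlinarith
  · interval_cases n <;> norm_num at h3 h4 <;> interval_cases K <;> omega

lemma le_threshold (h : IsArcThreshold n K) (hn : 2 ≤ n) {w : ℤ} (hw : 4 * w ≤ (n + 1) ^ 2) :
    w ≤ K := by
  rcases le_or_gt 4 n with h4 | h4
  · have := h.two_mul_le h4 hw
    have := h.lower
    nlinarith
  · have : n = 2 ∨ n = 3 := by omega
    rcases this with rfl | rfl
    · have := h.eq_two; omega
    · have := h.eq_six; omega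

lemma iso_bound_of_lt (h : IsArcThreshold n K) (hn : 2 ≤ n) {M w x x' y p q z' : ℤ}
    (hM : 2 * M = n ^ 2 * (n ^ 2 + 1)) (hw : 4 * w ≤ (n + 1) ^ 2) (hw0 : 0 < w)
    (hx : 0 ≤ x) (hy : 0 ≤ y) (hs : x + y ≤ M)
    (hv : x + p + x' = n ^ 3 + 1) (hz' : y + z' ≤ n ^ 4 - n ^ 3 + n ^ 2)
    (hq : x * x' ≤ q * w)
    (hcs : (x' * n ^ 2) ^ 2 ≤ z' * (x' * (n ^ 2 + (x' - 1)))) (hx' : K < x') (hp : 0 ≤ p) :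
    (x + y) * (n ^ 3 + 1 - K) ≤ (p + q) * M := by
  have hl := h.lower
  have hu := h.upper
  have hK : 0 ≤ K := by nlinarith
  have hM0 : 0 < M := by nlinarith
  have hD : n ^ 3 + 1 - K ≤ M := by nlinarith [sq_nonneg (n - 1), sq_nonneg (n ^ 2 - n)]
  have hn2 : 4 ≤ n ^ 2 := by nlinarith
  have hcs' : x' * n ^ 4 ≤ z' * (n ^ 2 + (x' - 1)) := by
    have : x' * (x' * n ^ 4) ≤ x' * (z' * (n ^ 2 + (x' - 1))) := by linarith
    exact le_of_mul_le_mul_left this (by linarith)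
  have hy2 : y * (n ^ 2 - 1 + x') ≤ n ^ 2 * (n - 1) * (n ^ 3 + 1 - x') := by
    have h1 := mul_le_mul_of_nonneg_right hz' (show 0 ≤ n ^ 2 - 1 + x' by linarith)
    linarith
  have hvx : 0 ≤ n ^ 3 + 1 - x' := by linarith
  have hcoef : (n ^ 3 + 1 - K) * (n ^ 2 * (n - 1)) ≤ M * (n ^ 2 - 1 + x') := by
    have h1 : 2 * (n ^ 3 + 1 - K) * (n - 1) ≤ (n ^ 2 + 1) * (n ^ 2 + K) := by
      have h2 := mul_le_mul_of_nonneg_right hl (show 0 ≤ n ^ 2 + 2 * n - 1 by linarith)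
      have h3 : 4 * n ^ 2 ≤ 2 * n ^ 3 := by
        have := mul_le_mul_of_nonneg_right hn (sq_nonneg n)
        linarith
      linarith
    have h2 : (n ^ 2 + 1) * (n ^ 2 + K) ≤ (n ^ 2 + 1) * (n ^ 2 - 1 + x') := by
      gcongr ?_ * ?_
      linarith
    have h3 := mul_le_mul_of_nonneg_left (h1.trans h2) (sq_nonneg n)
    have h4 : 2 * M * (n ^ 2 - 1 + x') = n ^ 2 * (n ^ 2 + 1) * (n ^ 2 - 1 + x') := by rw [hM]
    linarith
  have hyD : y * (n ^ 3 + 1 - K) ≤ (n ^ 3 + 1 - x') * M := by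
    have h1 := mul_le_mul_of_nonneg_left hcoef hvx
    have h2 := mul_le_mul_of_nonneg_right hy2 (show 0 ≤ n ^ 3 + 1 - K by linarith)
    have h3 : (n ^ 2 - 1 + x') * (y * (n ^ 3 + 1 - K)) ≤
        (n ^ 2 - 1 + x') * ((n ^ 3 + 1 - x') * M) := by linarith
    exact le_of_mul_le_mul_left h3 (by linarith)
  suffices hxD : x * (n ^ 3 + 1 - K) + x * M ≤ q * M ∨ n ^ 3 + 1 - K ≤ p + q by
    rcases hxD with hxD | hN
    · have : p = n ^ 3 + 1 - x' - x := by linarith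
      rw [this]
      linarith
    · rw [mul_comm]
      exact mul_le_mul hN hs (by linarith) (by nlinarith)
  have hxx : x * (K + 1) ≤ q * w := by
    have := mul_le_mul_of_nonneg_left (show K + 1 ≤ x' by linarith) hx
    linarith
  rcases le_or_gt 4 n with h4 | h4
  · left
    have h5 := mul_le_mul_of_nonneg_left (h.two_mul_le h4 hw) hx
    have h6 : 2 * x ≤ q := le_of_mul_le_mul_right (by linarith) hw0
    have h7 := mul_le_mul_of_nonneg_left hD hx
    nlinarith
  · have : n = 2 ∨ n = 3 := by omega
    have hq0 : 0 ≤ q := by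
      by_contra hq0
      nlinarith
    rcases this with rfl | rfl
    · obtain rfl := h.eq_two
      obtain rfl : M = 10 := by omega
      have hw2 : w ≤ 2 := by omega
      have h8 := mul_le_mul_of_nonneg_left hw2 hq0
      rcases (show x' = 3 ∨ 4 ≤ x' by omega) with rfl | h9
      · omega
      · left
        nlinarith
    · obtain rfl := h.eq_six
      obtain rfl : M = 45 := by omega
      have hw2 : w ≤ 4 := by omega
      have h8 := mul_le_mul_of_nonneg_left hw2 hq0
      left
      omega

lemma iso_bound_of_le (h : IsArcThreshold n K) (hn : 2 ≤ n) {M w x x' y p q z : ℤ}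
    (hM : 2 * M = n ^ 2 * (n ^ 2 + 1)) (hw : 4 * w ≤ (n + 1) ^ 2) (hw0 : 0 < w)
    (hx : 0 ≤ x) (hx'0 : 0 ≤ x') (hq0 : 0 ≤ q) (hs : x + y ≤ M)
    (hv : x + p + x' = n ^ 3 + 1) (hz : z ≤ y + q) (hq : x * x' ≤ q * w)
    (hbon : ∀ m : ℤ, 0 ≤ m → m ≤ x → 2 * m * n ^ 2 - m * (m - 1) ≤ 2 * z) (hx' : x' ≤ K) :
    n ^ 3 + 1 - K ≤ p + q := by
  have hl := h.lower
  have hu := h.upper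
  have hK : 0 ≤ K := by nlinarith
  have hwK := h.le_threshold hn hw
  suffices x + x' - K ≤ q by linarith
  rcases le_or_gt x K with hxK | hxK
  · by_contra! hc
    nlinarith [mul_nonneg (sub_nonneg.2 hxK) (sub_nonneg.2 hx')]
  rcases le_or_gt (n ^ 2) x with hxn | hxn
  · have := hbon (n ^ 2) (sq_nonneg n) hxn
    nlinarith
  rcases le_or_gt (x' + 1) (x - K) with hj | hj
  · have h1 := hbon x hx le_rfl
    have h2 := h.eval_succ_neg
    have h3 : 2 * M - 4 * K + 2 * x - 2 - 1 ≤ 2 * z := by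
      nlinarith [mul_nonneg (show 0 ≤ x - K - 1 by linarith)
        (show 0 ≤ 2 * n ^ 2 - x - K - 1 - 1 by linarith)]
    omega
  rcases le_or_gt 4 n with h4 | h4
  · have h5 := mul_le_mul_of_nonneg_right
      ((h.two_mul_le h4 hw).trans (show K + 1 ≤ x by linarith)) hx'0
    have h6 : 2 * x' ≤ q := le_of_mul_le_mul_right (by linarith) hw0
    linarith
  · have : n = 2 ∨ n = 3 := by omega
    rcases this with rfl | rfl
    · obtain rfl := h.eq_two
      have h8 := mul_le_mul_of_nonneg_left (show w ≤ 2 by omega) hq0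
      obtain rfl : x = 3 := by omega
      omega
    · obtain rfl := h.eq_six
      have h8 := mul_le_mul_of_nonneg_left (show w ≤ 4 by omega) hq0
      rcases (show x = 7 ∨ x = 8 by omega) with rfl | rfl <;> omega

end IsArcThreshold

namespace TwoDesign

/-- A pair `(X, Y)` occupying at most half of the incidence graph of a unital has a
neighbourhood that is at least as large, relative to its size, as the extremal one. -/
lemma IsUnital.iso_bound {D : TwoDesign α} {n : ℕ} (hU : D.IsUnital n) (hn : 2 ≤ n) {M K : ℤ}
    (hM : 2 * M = (n : ℤ) ^ 2 * ((n : ℤ) ^ 2 + 1)) (hK : IsArcThreshold n K)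
    {X : Finset α} {Y : Finset (Finset α)} (hX : X ⊆ D.points) (hY : Y ⊆ D.blocks)
    (hs : (X.card : ℤ) + Y.card ≤ M) :
    ((X.card : ℤ) + Y.card) * ((n : ℤ) ^ 3 + 1 - K) ≤
      ((D.pointNbhd Y \ X).card + (D.blockNbhd X \ Y).card) * M := by
  obtain ⟨hv, hb, hr, hk, hl⟩ := hU
  have hN : D.pointNbhd Y ⊆ D.points := filter_subset _ _
  set Z := (D.points \ X) \ (D.pointNbhd Y \ X) with hZdef
  have hZ : Z ⊆ D.points := sdiff_subset.trans sdiff_subset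
  have hXZ : Disjoint X Z := disjoint_sdiff.mono_right sdiff_subset
  have hZY : Disjoint (D.blockNbhd Z) Y := by
    rw [disjoint_left]
    intro B hB hBY
    obtain ⟨-, p, hp, hpB⟩ := mem_filter.1 hB
    rw [hZdef, mem_sdiff, mem_sdiff] at hp
    exact hp.2 (mem_sdiff.2 ⟨mem_filter.2 ⟨hp.1.1, B, hBY, hpB⟩, hp.1.2⟩)
  have hpts : X.card + (D.pointNbhd Y \ X).card + Z.card = n ^ 3 + 1 := by
    have h1 := card_sdiff_add_card_eq_card (sdiff_subset_sdiff hN (le_refl X))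
    have h2 := card_sdiff_add_card_eq_card hX
    have h3 := D.card_points
    rw [← hZdef] at h1
    omega
  have hYZ : Y.card + (D.blockNbhd Z).card ≤ D.b := by
    rw [← D.card_blocks, add_comm, ← card_union_of_disjoint hZY]
    exact card_le_card (union_subset (D.blockNbhd_subset Z) hY)
  have hXY : (D.blockNbhd X).card ≤ Y.card + (D.blockNbhd X \ Y).card := by
    have := le_card_sdiff Y (D.blockNbhd X)
    omega
  have hXZq : X.card * Z.card ≤ (D.blockNbhd X \ Y).card * ((n + 1) ^ 2 / 4) := by
    have h1 := D.card_mul_card_le hX hZ hXZ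
    rw [hl, mul_one, hk] at h1
    refine h1.trans (Nat.mul_le_mul_right _ (card_le_card fun B hB => ?_))
    rw [mem_inter] at hB
    exact mem_sdiff.2 ⟨hB.1, disjoint_left.1 hZY hB.2⟩
  have hw : 4 * ((n + 1) ^ 2 / 4) ≤ (n + 1) ^ 2 := Nat.mul_div_le _ _
  have hw0 : 0 < (n + 1) ^ 2 / 4 := Nat.div_pos (by nlinarith) (by norm_num)
  have hcs := D.sq_card_mul_le hZ
  rw [hr, hl] at hcs
  push_cast at hcs
  rw [mul_one] at hcs
  have hbon (m : ℤ) (h0 : 0 ≤ m) (hm : m ≤ X.card) :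
      2 * m * (n : ℤ) ^ 2 - m * (m - 1) ≤ 2 * ((D.blockNbhd X).card : ℤ) := by
    lift m to ℕ using h0
    obtain ⟨X₀, hX₀, rfl⟩ := exists_subset_card_eq (Nat.cast_le.1 hm)
    have h1 := D.two_mul_card_blockNbhd_ge (hX₀.trans hX)
    have h2 := card_le_card (D.blockNbhd_mono hX₀)
    rw [hr, hl] at h1
    push_cast at h1
    rw [mul_one] at h1
    omega
  have hb' : (D.b : ℤ) = (n : ℤ) ^ 4 - (n : ℤ) ^ 3 + (n : ℤ) ^ 2 := by
    have : n ^ 3 ≤ n ^ 4 := Nat.pow_le_pow_right (by omega) (by norm_num)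
    rw [hb]
    push_cast [this]
    ring
  generalize (n + 1) ^ 2 / 4 = w at *
  have hn' : (2 : ℤ) ≤ n := by exact_mod_cast hn
  zify at hpts hYZ hXY hXZq hw hw0
  rw [hb'] at hYZ
  rcases lt_or_ge K Z.card with hc | hc
  · exact hK.iso_bound_of_lt hn' hM hw hw0 (by positivity) (by positivity) hs hpts hYZ hXZq hcs hc
      (by positivity)
  · have h := hK.iso_bound_of_le hn' hM hw hw0 (by positivity) (by positivity) (by positivity) hs
      hpts hXY hXZq hbon hc
    have hM0 : 0 ≤ M := by nlinarith [sq_nonneg (n : ℤ)]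
    rw [mul_comm]
    exact mul_le_mul h hs (by positivity) (by positivity)

lemma exists_subset_card_eq_of_le_maxArc (D : TwoDesign α) {m : ℕ} (h0 : 0 < m)
    (hm : m ≤ maxArc D) :
    ∃ X ⊆ D.points, X.card = m ∧ ∀ B ∈ D.blocks, (B ∩ X).card ≤ 2 := by
  have hne : {k : ℕ | ∃ X : Finset α, D.IsArc X ∧ X.card = k}.Nonempty := by
    by_contra h
    rw [Set.not_nonempty_iff_eq_empty] at h
    rw [maxArc, h, csSup_empty, bot_eq_zero] at hm
    omega
  have hbdd : BddAbove {k : ℕ | ∃ X : Finset α, D.IsArc X ∧ X.card = k} := by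
    refine ⟨D.points.card, ?_⟩
    rintro _ ⟨X, hX, rfl⟩
    exact card_le_card hX.1
  obtain ⟨A, ⟨hA, -, hA2⟩, hcard⟩ := Nat.sSup_mem hne hbdd
  obtain ⟨X, hXA, hX⟩ := exists_subset_card_eq (hm.trans hcard.ge)
  exact ⟨X, hXA.trans hA, hX, fun B hB =>
    (card_le_card (inter_subset_inter_left hXA)).trans (hA2 B hB)⟩

/-- A set of points with no three collinear, together with enough blocks including all those
it meets, fills half of the incidence graph and has a small neighbourhood. -/
lemma IsUnital.exists_half {D : TwoDesign α} {n : ℕ} (hU : D.IsUnital n) (hn : 2 ≤ n) {M K : ℕ}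
    (hM : 2 * M = n ^ 2 * (n ^ 2 + 1)) (hK : IsArcThreshold n K) (hmax : K ≤ maxArc D) :
    ∃ X ⊆ D.points, ∃ Y ⊆ D.blocks, X.card + Y.card = M ∧
      (D.pointNbhd Y \ X).card + (D.blockNbhd X \ Y).card + K ≤ n ^ 3 + 1 := by
  obtain ⟨hv, hb, hr, hk, hl⟩ := hU
  have hn' : (2 : ℤ) ≤ n := by exact_mod_cast hn
  have hK0 : 0 < K := by
    rcases hn.eq_or_lt with rfl | h
    · have := hK.eq_two
      omega
    · have := hK.lower
      have h3 : (3 : ℤ) ≤ n := by exact_mod_cast h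
      zify
      nlinarith
  obtain ⟨X, hX, hXK, hX2⟩ := D.exists_subset_card_eq_of_le_maxArc hK0 hmax
  have h1 := D.two_mul_card_blockNbhd_of_card_inter_le_two hX hX2
  rw [hr, hl, hXK] at h1
  push_cast at h1
  have hNM : (D.blockNbhd X).card + K ≤ M := by
    zify at hM ⊢
    linarith [hK.eval_nonneg]
  have hMb : M - K ≤ D.blocks.card := by
    have h34 : 2 * n ^ 3 ≤ n ^ 4 := by nlinarith [Nat.mul_le_mul_right (n ^ 3) hn]
    have h4 : n ^ 2 * (n ^ 2 + 1) = n ^ 4 + n ^ 2 := by ring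
    rw [D.card_blocks, hb]
    omega
  obtain ⟨Y, hXY, hY, hYc⟩ := exists_subsuperset_card_eq (D.blockNbhd_subset X)
    (show (D.blockNbhd X).card ≤ M - K by omega) hMb
  refine ⟨X, hX, Y, hY, by omega, ?_⟩
  rw [sdiff_eq_empty_iff_subset.2 hXY, card_empty]
  have h5 : (D.pointNbhd Y \ X).card ≤ (D.points \ X).card :=
    card_le_card (sdiff_subset_sdiff (filter_subset _ _) le_rfl)
  have h6 := card_sdiff_add_card_eq_card hX
  have h7 := D.card_points
  omega

end TwoDesign

theorem iso_inc_exact_of_large_arc (n : ℕ) (hn : 2 ≤ n) (D : TwoDesign α)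
    (hU : D.IsUnital n) (hArc : (⌊cFun n⌋ : ℤ) ≤ (maxArc D : ℤ)) :
    isoInc D = 2 * ((n : ℝ) ^ 3 + 1 - (⌊cFun n⌋ : ℝ)) /
      ((n : ℝ) ^ 2 * ((n : ℝ) ^ 2 + 1)) := by
  have hK := isArcThreshold_floor_cFun hn
  have hn' : (2 : ℤ) ≤ n := by exact_mod_cast hn
  obtain ⟨M, hM⟩ : ∃ M : ℕ, n ^ 2 * (n ^ 2 + 1) = 2 * M := (Nat.even_mul_succ_self _).two_dvd
  have hK0 : 0 ≤ ⌊cFun n⌋ := by nlinarith [hK.lower]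
  generalize ⌊cFun n⌋ = K at *
  lift K to ℕ using hK0
  have hM0 : 0 < M := by
    have : 0 < n ^ 2 * (n ^ 2 + 1) := by positivity
    omega
  have hMR : (n : ℝ) ^ 2 * ((n : ℝ) ^ 2 + 1) = 2 * M := by exact_mod_cast hM
  have hM0R : (0 : ℝ) < M := by exact_mod_cast hM0
  have hsize : D.v + D.b = 2 * M + 1 := by
    have h34 : n ^ 3 ≤ n ^ 4 := Nat.pow_le_pow_right (by omega) (by norm_num)
    have h4 : n ^ 2 * (n ^ 2 + 1) = n ^ 4 + n ^ 2 := by ring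
    rw [hU.1, hU.2.1]
    omega
  rw [hMR, mul_div_mul_left _ _ two_ne_zero, Int.cast_natCast]
  obtain ⟨X₀, hX₀, Y₀, hY₀, hcard, hnbhd⟩ := hU.exists_half hn hM.symm hK (by exact_mod_cast hArc)
  unfold isoInc
  apply le_antisymm
  · refine csInf_le_of_le ⟨0, ?_⟩
      ⟨X₀, hX₀, Y₀, hY₀, by omega, by omega, rfl⟩ ?_
    · rintro _ ⟨X, -, Y, -, -, -, rfl⟩
      positivity
    · rw [hcard]
      gcongr
      rw [le_sub_iff_add_le]
      exact_mod_cast hnbhd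
  · refine le_csInf ⟨_, X₀, hX₀, Y₀, hY₀, by omega, by omega, rfl⟩ ?_
    rintro _ ⟨X, hX, Y, hY, hpos, hhalf, rfl⟩
    have h := hU.iso_bound hn (M := M) (by exact_mod_cast hM.symm) hK hX hY (by omega)
    have hposR : (0 : ℝ) < ((X.card + Y.card : ℕ) : ℝ) := by exact_mod_cast hpos
    rw [div_le_div_iff₀ hM0R hposR, mul_comm]
    rify at h
    push_cast
    exact h
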